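/- arXiv:1706.07607 — 5 statements merged into one kernel-verified Lean document; each statement's English description precedes it below -/
import Mathlib

section
/- Let f : ℕ → ℝ satisfy f(k) > 0 for all k ≥ 1, and suppose λ* > 0 satisfies ρ_f(λ*) = 1. With p_k = (λ*/(λ* + f(k))) ∏_{j=1}^{k−1} f(j)/(λ* + f(j)), one has ∑_{k=1}^∞ f(k) p_k = λ*. -/
open scoped ENNReal

/-- `ρ_f(λ) = ∑_{l=1}^∞ ∏_{k=1}^l f(k)/(λ + f(k))`, as an element of `[0,∞]`. -/
noncomputable def rhoPA (f : ℕ → ℝ) (lam : ℝ) : ℝ≥0∞ :=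
  ∑' l : ℕ, ENNReal.ofReal (∏ k ∈ Finset.Icc 1 (l + 1), f k / (lam + f k))

/-- The limiting degree distribution
`p_k = (λ*/(λ* + f(k))) ∏_{j=1}^{k−1} f(j)/(λ* + f(j))`. -/
noncomputable def pPA (f : ℕ → ℝ) (lam : ℝ) (k : ℕ) : ℝ :=
  (lam / (lam + f k)) * ∏ j ∈ Finset.Icc 1 (k - 1), f j / (lam + f j)

/-- If `λ* > 0` satisfies `ρ_f(λ*) = 1`, then `∑_{k=1}^∞ f(k) p_k = λ*`. -/
theorem tsum_f_mul_pPA_eq_malthusian (f : ℕ → ℝ) (hf : ∀ k, 1 ≤ k → 0 < f k)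
    (lam : ℝ) (hlam : 0 < lam) (hmalthus : rhoPA f lam = 1) :
    ∑' k : ℕ, f (k + 1) * pPA f lam (k + 1) = lam := by
  have hpos : ∀ l : ℕ, 0 ≤ ∏ k ∈ Finset.Icc 1 (l + 1), f k / (lam + f k) := fun l =>
    Finset.prod_nonneg fun k hk => by
      have := hf k (Finset.mem_Icc.mp hk).1
      positivity
  have hterm : ∀ k : ℕ, f (k + 1) * pPA f lam (k + 1) =
      lam * ∏ j ∈ Finset.Icc 1 (k + 1), f j / (lam + f j) := fun k => by
    rw [pPA, Finset.prod_Icc_succ_top (by omega), Nat.add_sub_cancel]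
    ring
  have hsum : ∑' l : ℕ, ∏ k ∈ Finset.Icc 1 (l + 1), f k / (lam + f k) = 1 := by
    have h := congrArg ENNReal.toReal hmalthus
    rw [rhoPA, ENNReal.tsum_toReal_eq fun _ => ENNReal.ofReal_ne_top] at h
    simpa only [ENNReal.toReal_ofReal (hpos _), ENNReal.toReal_one] using h
  simp_rw [hterm]
  rw [tsum_mul_left, hsum, mul_one]
end

section
/- Let f : ℕ → ℝ satisfy f(k) > 0 for all k ≥ 1, and suppose λ* > 0 satisfies ρ_f(λ*) = 1. With p_k = (λ*/(λ* + f(k))) ∏_{j=1}^{k−1} f(j)/(λ* + f(j)), for every k ≥ 1 the tail of the distribution equals the rescaled preference toward degree k: ∑_{j=k+1}^∞ p_j = f(k) p_k / λ*. -/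
open scoped ENNReal

/-- The partial product `∏_{j=1}^n f(j)/(λ + f(j))` is nonnegative. -/
theorem prod_div_add_nonneg {f : ℕ → ℝ} (hf : ∀ k, 1 ≤ k → 0 < f k) {lam : ℝ} (hlam : 0 < lam)
    (n : ℕ) : 0 ≤ ∏ j ∈ Finset.Icc 1 n, f j / (lam + f j) := by
  refine Finset.prod_nonneg fun j hj => ?_
  have := hf j (Finset.mem_Icc.mp hj).1
  positivity

/-- The weights `p_k` telescope: they are differences of consecutive partial products. -/
theorem pPA_succ_eq_sub {f : ℕ → ℝ} (hf : ∀ k, 1 ≤ k → 0 < f k) {lam : ℝ} (hlam : 0 < lam)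
    (n : ℕ) :
    pPA f lam (n + 1) = ∏ j ∈ Finset.Icc 1 n, f j / (lam + f j)
      - ∏ j ∈ Finset.Icc 1 (n + 1), f j / (lam + f j) := by
  have h : lam + f (n + 1) ≠ 0 := by
    have := hf (n + 1) (by omega)
    positivity
  rw [Finset.prod_Icc_succ_top (by omega), pPA, Nat.add_sub_cancel]
  field_simp
  ring

theorem pPA_succ_nonneg {f : ℕ → ℝ} (hf : ∀ k, 1 ≤ k → 0 < f k) {lam : ℝ} (hlam : 0 < lam)
    (n : ℕ) : 0 ≤ pPA f lam (n + 1) := by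
  have := hf (n + 1) (by omega)
  exact mul_nonneg (by positivity) (prod_div_add_nonneg hf hlam _)

/-- If `ρ_f(λ)` is finite, the partial products tend to zero. -/
theorem tendsto_prod_div_add_zero {f : ℕ → ℝ} (hf : ∀ k, 1 ≤ k → 0 < f k) {lam : ℝ}
    (hlam : 0 < lam) (h : rhoPA f lam ≠ ∞) :
    Filter.Tendsto (fun n => ∏ j ∈ Finset.Icc 1 n, f j / (lam + f j)) Filter.atTop (nhds 0) := by
  have hs := (ENNReal.summable_toReal h).tendsto_atTop_zero
  simp only [ENNReal.toReal_ofReal (prod_div_add_nonneg hf hlam _)] at hs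
  exact (Filter.tendsto_add_atTop_iff_nat
    (f := fun n => ∏ j ∈ Finset.Icc 1 n, f j / (lam + f j)) 1).mp hs

/-- If `ρ_f(λ)` is finite, the weights beyond `k` sum to the partial product up to `k`. -/
theorem hasSum_pPA_tail {f : ℕ → ℝ} (hf : ∀ k, 1 ≤ k → 0 < f k) {lam : ℝ}
    (hlam : 0 < lam) (h : rhoPA f lam ≠ ∞) (k : ℕ) :
    HasSum (fun j => pPA f lam (k + 1 + j)) (∏ j ∈ Finset.Icc 1 k, f j / (lam + f j)) := by
  simp only [Nat.add_right_comm k 1]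
  rw [hasSum_iff_tendsto_nat_of_nonneg fun j => pPA_succ_nonneg hf hlam _]
  have hsum (n : ℕ) := Finset.sum_range_sub'
    (fun i => ∏ j ∈ Finset.Icc 1 (k + i), f j / (lam + f j)) n
  simp only [← add_assoc, add_zero] at hsum
  simp only [pPA_succ_eq_sub hf hlam, hsum]
  have ht := (Filter.tendsto_add_atTop_iff_nat k).mpr (tendsto_prod_div_add_zero hf hlam h)
  simpa [add_comm] using ht.const_sub (∏ j ∈ Finset.Icc 1 k, f j / (lam + f j))

/-- If `λ* > 0` satisfies `ρ_f(λ*) = 1`, then for every `k ≥ 1` the tail of the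
distribution equals the rescaled preference toward degree `k`:
`∑_{j=k+1}^∞ p_j = f(k) p_k / λ*`. -/
theorem pPA_tail_eq_rescaled_pref (f : ℕ → ℝ) (hf : ∀ k, 1 ≤ k → 0 < f k)
    (lam : ℝ) (hlam : 0 < lam) (hmalthus : rhoPA f lam = 1) (k : ℕ) (hk : 1 ≤ k) :
    ∑' j : ℕ, pPA f lam (k + 1 + j) = f k * pPA f lam k / lam := by
  rw [(hasSum_pPA_tail hf hlam (by simp [hmalthus]) k).tsum_eq]
  obtain ⟨n, rfl⟩ : ∃ n, k = n + 1 := ⟨k - 1, by omega⟩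
  rw [Finset.prod_Icc_succ_top (by omega), pPA, Nat.add_sub_cancel]
  field_simp
end

section
/- Let f : ℕ → ℝ satisfy f(k) > 0 for all k ≥ 1. If ρ_f(λ₀) < ∞ for some λ₀ > 0, then ρ_f(λ) → 0 as λ → ∞. -/
open scoped ENNReal
open Filter

/-- Each finite product appearing in `rhoPA` tends to `0` as the parameter tends to infinity. -/
theorem tendsto_prod_div_add_atTop (f : ℕ → ℝ) (l : ℕ) :
    Tendsto (fun lam : ℝ => ∏ k ∈ Finset.Icc 1 (l + 1), f k / (lam + f k)) atTop (nhds 0) := by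
  have h : Tendsto (fun lam : ℝ => ∏ k ∈ Finset.Icc 1 (l + 1), f k / (lam + f k)) atTop
      (nhds (∏ _k ∈ Finset.Icc 1 (l + 1), (0 : ℝ))) :=
    tendsto_finsetProd _ fun k _ =>
      (tendsto_atTop_add_const_right _ (f k) tendsto_id).const_div_atTop (f k)
  simpa using h

/-- The finite products appearing in `rhoPA` are antitone in the parameter. -/
theorem prod_div_add_le_prod_div_add {f : ℕ → ℝ} (hf : ∀ k, 1 ≤ k → 0 < f k) {a b : ℝ}
    (ha : 0 < a) (hab : a ≤ b) (l : ℕ) :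
    ∏ k ∈ Finset.Icc 1 (l + 1), f k / (b + f k) ≤
      ∏ k ∈ Finset.Icc 1 (l + 1), f k / (a + f k) := by
  refine Finset.prod_le_prod (fun k hk => ?_) (fun k hk => ?_) <;>
    have hk' := hf k (Finset.mem_Icc.1 hk).1
  · have := ha.trans_le hab
    positivity
  · gcongr

/-- If `ρ_f(λ₀) < ∞` for some `λ₀ > 0`, then `ρ_f(λ) → 0` as `λ → ∞`. -/
theorem rhoPA_tendsto_zero_atTop (f : ℕ → ℝ) (hf : ∀ k, 1 ≤ k → 0 < f k)
    (lam₀ : ℝ) (h₀ : 0 < lam₀) (hfin : rhoPA f lam₀ < ⊤) :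
    Tendsto (fun lam : ℝ => rhoPA f lam) atTop (nhds 0) := by
  simp only [rhoPA, ← MeasureTheory.lintegral_count] at hfin ⊢
  have h := MeasureTheory.tendsto_lintegral_filter_of_dominated_convergence
    (μ := MeasureTheory.Measure.count) (l := (atTop : Filter ℝ))
    (F := fun (lam : ℝ) (l : ℕ) =>
      ENNReal.ofReal (∏ k ∈ Finset.Icc 1 (l + 1), f k / (lam + f k)))
    (f := fun _ => 0) _
    (Eventually.of_forall fun _ => measurable_of_countable _)
    ((eventually_ge_atTop lam₀).mono fun _ hlam => Eventually.of_forall fun l =>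
      ENNReal.ofReal_le_ofReal (prod_div_add_le_prod_div_add hf h₀ hlam l))
    hfin.ne
    (Eventually.of_forall fun l => by
      simpa using ENNReal.tendsto_ofReal (tendsto_prod_div_add_atTop f l))
  simpa using h
end

section
/- Let f : ℕ → ℝ satisfy f(k) > 0 for all k ≥ 1, and suppose there exist δ ≥ 0 and 0 < β < 1 such that f(k) ≤ (k+δ)^β for every k ≥ 1. Then ρ_f(λ) < ∞ for every λ > 0. -/
open scoped ENNReal

open Filter

/-- A strongly sublinear function is eventually below any positive multiple of the identity. -/
lemma eventually_add_rpow_le_mul {δ β c : ℝ} (hβ : β < 1) (hc : 0 < c) :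
    ∀ᶠ k : ℕ in atTop, ((k : ℝ) + δ) ^ β ≤ c * k := by
  have hlim : Tendsto (fun k : ℕ => (k : ℝ) + δ) atTop atTop :=
    tendsto_atTop_add_const_right _ δ tendsto_natCast_atTop_atTop
  have hsmall : ∀ᶠ x : ℝ in atTop, x ^ β ≤ c / 2 * x := by
    filter_upwards [(tendsto_rpow_neg_atTop (sub_pos.2 hβ)).eventually_le_const (half_pos hc),
      eventually_gt_atTop 0] with x hx hx0
    calc x ^ β = x ^ (-(1 - β)) * x := by
          rw [← Real.rpow_add_one hx0.ne']
          ring_nf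
      _ ≤ c / 2 * x := by gcongr
  filter_upwards [hlim.eventually hsmall,
    tendsto_natCast_atTop_atTop.eventually_ge_atTop δ] with k hk hkδ
  nlinarith

/-- If `f k ≤ λ k / 2` for large `k`, then the partial products of `f k / (λ + f k)` decay at
least quadratically, so that they are summable. -/
lemma summable_prod_div_add_of_eventually_le {f : ℕ → ℝ} (hf : ∀ k, 1 ≤ k → 0 < f k) {lam : ℝ}
    (hlam : 0 < lam) (hle : ∀ᶠ k : ℕ in atTop, f k ≤ lam / 2 * k) :
    Summable fun l : ℕ => ∏ k ∈ Finset.Icc 1 l, f k / (lam + f k) := by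
  set P : ℕ → ℝ := fun l => ∏ k ∈ Finset.Icc 1 l, f k / (lam + f k) with hP
  have hP0 (l : ℕ) : 0 ≤ P l := Finset.prod_nonneg fun k hk => by
    have := hf k (Finset.mem_Icc.1 hk).1
    positivity
  obtain ⟨N, hN⟩ := eventually_atTop.1 hle
  have hbound (l : ℕ) (hl : N ≤ l) :
      P l * ((l + 1) * (l + 2)) ≤ P N * ((N + 1) * (N + 2)) := by
    induction l, hl using Nat.le_induction with
    | base => exact le_rfl
    | succ l hl ih =>
      refine le_trans ?_ ih
      have hpos := hf (l + 1) (by lia)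
      have hfl := hN (l + 1) (by lia)
      push_cast at hfl
      have hratio : f (l + 1) / (lam + f (l + 1)) ≤ (l + 1) / (l + 3) := by
        rw [div_le_div_iff₀ (by positivity) (by positivity)]
        nlinarith
      calc P (l + 1) * ((((l + 1 : ℕ) : ℝ) + 1) * (((l + 1 : ℕ) : ℝ) + 2))
          = P l * (f (l + 1) / (lam + f (l + 1))) * ((l + 2) * (l + 3)) := by
            simp only [hP]
            rw [Finset.prod_Icc_succ_top (by lia)]
            push_cast
            ring
        _ ≤ P l * ((l + 1) / (l + 3)) * ((l + 2) * (l + 3)) := by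
            have := hP0 l
            gcongr
        _ = P l * ((l + 1) * (l + 2)) := by
            field_simp
  have hsq : Summable fun l : ℕ => P N * ((N + 1) * (N + 2)) * (1 / ((l + 1 : ℕ) : ℝ) ^ 2) :=
    ((summable_nat_add_iff 1).2 (Real.summable_one_div_nat_pow.2 one_lt_two)).mul_left _
  refine hsq.of_norm_bounded_eventually_nat ?_
  filter_upwards [eventually_ge_atTop N] with l hl
  rw [Real.norm_of_nonneg (hP0 l), mul_one_div, le_div_iff₀ (by positivity)]
  refine le_trans ?_ (hbound l hl)
  have := hP0 l
  gcongr
  push_cast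
  nlinarith

/-- If `f` is strongly sublinear in the sense that `f(k) ≤ (k+δ)^β` for some `δ ≥ 0` and
`0 < β < 1`, then `ρ_f(λ) < ∞` for every `λ > 0`. -/
theorem rhoPA_lt_top_of_strongly_sublinear (f : ℕ → ℝ) (hf : ∀ k, 1 ≤ k → 0 < f k)
    (δ β : ℝ) (hδ : 0 ≤ δ) (hβ₀ : 0 < β) (hβ₁ : β < 1)
    (hsub : ∀ k, 1 ≤ k → f k ≤ ((k : ℝ) + δ) ^ β) (lam : ℝ) (hlam : 0 < lam) :
    rhoPA f lam < ⊤ := by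
  have hsum := summable_prod_div_add_of_eventually_le hf hlam <| by
    filter_upwards [eventually_add_rpow_le_mul (δ := δ) hβ₁ (half_pos hlam),
      eventually_ge_atTop 1] with k hk hk1 using (hsub k hk1).trans hk
  exact ((summable_nat_add_iff 1).2 hsum).tsum_ofReal_lt_top
end

section
/- Let δ ≥ 0 and f(k) = k + δ for k ≥ 1. Then for every λ > 1, ρ_f(λ) = ∑_{l=1}^∞ ∏_{k=1}^l (k+δ)/(λ + k + δ) = (1+δ)/(λ−1). In particular ρ_f(2+δ) = 1, so λ* = 2 + δ is the Malthusian parameter for the affine preferential attachment function f(k) = k + δ. -/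
open scoped ENNReal

/-- The product `∏_{k=1}^n (k+δ)/(λ+k+δ)`. -/
noncomputable def affineProd (δ lam : ℝ) (n : ℕ) : ℝ :=
  ∏ k ∈ Finset.Icc 1 n, ((k : ℝ) + δ) / (lam + ((k : ℝ) + δ))

/-- The tail of the series of the `affineProd δ lam l`, a telescoping primitive of its terms. -/
noncomputable def affineTail (δ lam : ℝ) (n : ℕ) : ℝ :=
  affineProd δ lam n * (n + 1 + δ) / (lam - 1)

lemma affineProd_nonneg {δ lam : ℝ} (hδ : 0 ≤ δ) (hlam : 1 < lam) (n : ℕ) :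
    0 ≤ affineProd δ lam n :=
  Finset.prod_nonneg fun _ _ => by positivity

lemma affineTail_nonneg {δ lam : ℝ} (hδ : 0 ≤ δ) (hlam : 1 < lam) (n : ℕ) :
    0 ≤ affineTail δ lam n :=
  div_nonneg (mul_nonneg (affineProd_nonneg hδ hlam n) (by positivity)) (by linarith)

lemma affineTail_sub_succ {δ lam : ℝ} (hδ : 0 ≤ δ) (hlam : 1 < lam) (n : ℕ) :
    affineTail δ lam n - affineTail δ lam (n + 1) = affineProd δ lam (n + 1) := by
  have h₁ : lam - 1 ≠ 0 := by linarith
  have h₂ : lam + ((n : ℝ) + 1 + δ) ≠ 0 := by positivity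
  have h : affineProd δ lam (n + 1) =
      affineProd δ lam n * (((n : ℝ) + 1 + δ) / (lam + ((n : ℝ) + 1 + δ))) := by
    rw [affineProd, Finset.prod_Icc_succ_top (by lia), Nat.cast_succ, affineProd]
  rw [affineTail, affineTail, h]
  push_cast
  field_simp
  ring

lemma sum_range_affineProd {δ lam : ℝ} (hδ : 0 ≤ δ) (hlam : 1 < lam) (n : ℕ) :
    ∑ l ∈ Finset.range n, affineProd δ lam (l + 1) = affineTail δ lam 0 - affineTail δ lam n := by
  rw [← Finset.sum_range_sub']
  exact Finset.sum_congr rfl fun l _ => (affineTail_sub_succ hδ hlam l).symm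

lemma antitone_affineTail {δ lam : ℝ} (hδ : 0 ≤ δ) (hlam : 1 < lam) :
    Antitone (affineTail δ lam) :=
  antitone_nat_of_succ_le fun n => by
    linarith [affineTail_sub_succ hδ hlam n, affineProd_nonneg hδ hlam (n + 1)]

lemma summable_affineProd {δ lam : ℝ} (hδ : 0 ≤ δ) (hlam : 1 < lam) :
    Summable (affineProd δ lam) :=
  (summable_nat_add_iff 1).1 <|
    summable_of_sum_range_le (fun n => affineProd_nonneg hδ hlam (n + 1)) fun n => by
      rw [sum_range_affineProd hδ hlam n]
      exact sub_le_self _ (affineTail_nonneg hδ hlam n)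

/-- The tails vanish: otherwise the summable sequence `affineProd δ lam` would dominate a multiple
of the harmonic series. -/
lemma tendsto_affineTail {δ lam : ℝ} (hδ : 0 ≤ δ) (hlam : 1 < lam) :
    Filter.Tendsto (affineTail δ lam) Filter.atTop (nhds 0) := by
  have hbdd : BddBelow (Set.range (affineTail δ lam)) :=
    ⟨0, Set.forall_mem_range.2 (affineTail_nonneg hδ hlam)⟩
  have hlim := tendsto_atTop_ciInf (antitone_affineTail hδ hlam) hbdd
  suffices h : ⨅ n, affineTail δ lam n = 0 by rwa [h] at hlim
  refine le_antisymm (not_lt.1 fun hpos => ?_) (le_ciInf (affineTail_nonneg hδ hlam))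
  set L := ⨅ n, affineTail δ lam n
  have hlam' : 0 < lam - 1 := by linarith
  have hsum : Summable fun n : ℕ => L * (lam - 1) * (1 / |(n : ℝ) + (1 + δ)| ^ (1 : ℝ)) := by
    refine (summable_affineProd hδ hlam).of_nonneg_of_le (fun n => by positivity) fun n => ?_
    have hn : 0 < (n : ℝ) + 1 + δ := by positivity
    have hL : L ≤ affineProd δ lam n * (n + 1 + δ) / (lam - 1) := ciInf_le hbdd n
    rw [Real.rpow_one, ← add_assoc, abs_of_pos hn, mul_one_div, div_le_iff₀ hn]
    exact (le_div_iff₀ hlam').1 hL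
  rw [summable_mul_left_iff (by positivity), Real.summable_one_div_nat_add_rpow] at hsum
  exact lt_irrefl _ hsum

lemma hasSum_affineProd {δ lam : ℝ} (hδ : 0 ≤ δ) (hlam : 1 < lam) :
    HasSum (fun l => affineProd δ lam (l + 1)) ((1 + δ) / (lam - 1)) := by
  rw [hasSum_iff_tendsto_nat_of_nonneg fun n => affineProd_nonneg hδ hlam (n + 1)]
  simp_rw [sum_range_affineProd hδ hlam]
  simpa [affineTail, affineProd] using (tendsto_affineTail hδ hlam).const_sub (affineTail δ lam 0)

lemma rhoPA_affine_eq {δ lam : ℝ} (hδ : 0 ≤ δ) (hlam : 1 < lam) :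
    rhoPA (fun k => (k : ℝ) + δ) lam = ENNReal.ofReal ((1 + δ) / (lam - 1)) := by
  rw [← (hasSum_affineProd hδ hlam).tsum_eq,
    ENNReal.ofReal_tsum_of_nonneg (fun n => affineProd_nonneg hδ hlam (n + 1))
      (hasSum_affineProd hδ hlam).summable]
  rfl

/-- For the affine preferential attachment function `f(k) = k + δ` with `δ ≥ 0`,
one has `ρ_f(λ) = (1+δ)/(λ−1)` for every `λ > 1`; in particular `ρ_f(2+δ) = 1`,
so `λ* = 2 + δ` is the Malthusian parameter. -/
theorem rhoPA_affine (δ : ℝ) (hδ : 0 ≤ δ) :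
    (∀ lam : ℝ, 1 < lam →
        rhoPA (fun k => (k : ℝ) + δ) lam = ENNReal.ofReal ((1 + δ) / (lam - 1))) ∧
      rhoPA (fun k => (k : ℝ) + δ) (2 + δ) = 1 := by
  refine ⟨fun lam hlam => rhoPA_affine_eq hδ hlam, ?_⟩
  have h : (1 + δ) / (2 + δ - 1) = 1 := by
    rw [div_eq_one_iff_eq (by linarith)]
    ring
  rw [rhoPA_affine_eq hδ (by linarith), h, ENNReal.ofReal_one]
end
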